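/- With the CGMY data below, assume in addition Y ∈ (7/6, 2). Define the coefficients a₂₁ := b̃²·σ_Y^{-1/Y}·Γ(1/Y)/(2πY), a₄₁ := -b̃⁴·σ_Y^{-3/Y}·Γ(3/Y)/(24πY), and a₁₂ := -(C·Γ(-Y)·(M̃ + G̃)·sin(Yπ/2)/π)·Γ(1 - 2/Y)·σ_Y^{(2-Y)/Y}. Then, as t → 0⁺, (t^{1/Y}·L(t) - d₁·t^{1/Y} - d₂·t - a₂₁·t^{2 - 1/Y} - a₄₁·t^{4 - 3/Y} - a₁₂·t^{2/Y}) / t^{max(2 - 1/Y, 2/Y)} → 0. (This is the five-term at-the-money expansion c(t,0) = d₁·t^{1/Y} + d₂·t + a₂₁·t^{2-1/Y} + a₄₁·t^{4-3/Y} + a₁₂·t^{2/Y} + o(t^{max(2-1/Y,2/Y)}) expressed through the Lipton–Lewis representation c(t,0) = t^{1/Y}·L(t).) -/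

import Mathlib

open MeasureTheory Filter Topology Complex

/-- The stable scale coefficient `σ_Y = 2·C·Γ(-Y)·|cos(πY/2)|`. -/
noncomputable def sigmaY (C Y : ℝ) : ℝ :=
  2 * C * Real.Gamma (-Y) * |Real.cos (Real.pi * Y / 2)|

/-- The martingale drift `b̃`. -/
noncomputable def btilde (C G M Y : ℝ) : ℝ :=
  -(C * Real.Gamma (-Y) * ((M - 1) ^ Y + (G + 1) ^ Y - M ^ Y - G ^ Y))

/-- The constant `κ = b̃/2 - C·Γ(-Y)·(M^Y + G^Y)`. -/
noncomputable def kappaC (C G M Y : ℝ) : ℝ :=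
  btilde C G M Y / 2 - C * Real.Gamma (-Y) * (M ^ Y + G ^ Y)

/-- The limiting stable exponent `θ₀(u) = -σ_Y·|u|^Y`. -/
noncomputable def theta0 (C Y : ℝ) (u : ℝ) : ℝ :=
  -(sigmaY C Y) * |u| ^ Y

/-- The contour-shifted characteristic exponent `ψ₀`. -/
noncomputable def psi0 (C G M Y : ℝ) (v : ℝ) : ℂ :=
  Complex.I * (v : ℂ) * ((btilde C G M Y : ℝ) : ℂ) + ((kappaC C G M Y : ℝ) : ℂ)
    + ((C * Real.Gamma (-Y) : ℝ) : ℂ) *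
      ((((M - 1/2 : ℝ) : ℂ) - Complex.I * (v : ℂ)) ^ (Y : ℂ)
        + (((G + 1/2 : ℝ) : ℂ) + Complex.I * (v : ℂ)) ^ (Y : ℂ))

/-- The rescaled exponent `θ(t,v)` in the Lipton–Lewis representation. -/
noncomputable def thetaT (C G M Y : ℝ) (t v : ℝ) : ℂ :=
  Complex.I * (v : ℂ) * ((btilde C G M Y : ℝ) : ℂ) * ((t ^ (1 - 1/Y) : ℝ) : ℂ)
    + ((kappaC C G M Y : ℝ) : ℂ) * (t : ℂ)
    + ((C * Real.Gamma (-Y) : ℝ) : ℂ) *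
      (((((M - 1/2) * t ^ (1/Y) : ℝ) : ℂ) - Complex.I * (v : ℂ)) ^ (Y : ℂ)
        + ((((G + 1/2) * t ^ (1/Y) : ℝ) : ℂ) + Complex.I * (v : ℂ)) ^ (Y : ℂ))

/-- The normalized Lipton–Lewis ATM factor `L(t)`. -/
noncomputable def LLfn (C G M Y : ℝ) (t : ℝ) : ℝ :=
  (1 / Real.pi) *
    (∫ v in Set.Ioi (0 : ℝ),
      (1 - Complex.exp (thetaT C G M Y t v)) / (((v ^ 2 + t ^ (2/Y) / 4 : ℝ)) : ℂ)).re

/-- The first-order coefficient `d₁`. -/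
noncomputable def dOne (C Y : ℝ) : ℝ :=
  (1 / Real.pi) * Real.Gamma (1 - 1/Y) * (sigmaY C Y) ^ (1/Y)

/-- The second-order coefficient `d₂`. -/
noncomputable def dTwo (C G M Y : ℝ) : ℝ :=
  (1 / Real.pi) * ∫ w in Set.Ioi (0 : ℝ),
    ((w ^ 2 + 1/4) * theta0 C Y w - w ^ 2 * (psi0 C G M Y w).re) / (w ^ 2 * (w ^ 2 + 1/4))

/-! ### The exponent -/

lemma Real.Gamma_neg_pos_of_mem_Ioo {Y : ℝ} (h1 : 1 < Y) (h2 : Y < 2) : 0 < Real.Gamma (-Y) := by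
  have e1 := Real.Gamma_add_one (s := -Y) (by linarith)
  have e2 := Real.Gamma_add_one (s := -Y + 1) (by linarith)
  have h : 0 < Real.Gamma (-Y + 1 + 1) := Real.Gamma_pos_of_pos (by linarith)
  rw [e2, e1, ← mul_assoc] at h
  exact pos_of_mul_pos_right h (mul_nonneg_of_nonpos_of_nonpos (by linarith) (by linarith))

lemma Real.cos_pi_mul_div_two_neg {Y : ℝ} (h1 : 1 < Y) (h2 : Y < 2) :
    Real.cos (Real.pi * Y / 2) < 0 :=
  Real.cos_neg_of_pi_div_two_lt_of_lt (by nlinarith [Real.pi_pos]) (by nlinarith [Real.pi_pos])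

lemma sigmaY_eq {C Y : ℝ} (h1 : 1 < Y) (h2 : Y < 2) :
    sigmaY C Y = -(2 * (C * Real.Gamma (-Y)) * Real.cos (Real.pi * Y / 2)) := by
  rw [sigmaY, abs_of_neg (Real.cos_pi_mul_div_two_neg h1 h2)]
  ring

lemma sigmaY_pos {C Y : ℝ} (hC : 0 < C) (h1 : 1 < Y) (h2 : Y < 2) : 0 < sigmaY C Y := by
  have := Real.Gamma_neg_pos_of_mem_Ioo h1 h2
  have := abs_pos.2 (Real.cos_pi_mul_div_two_neg h1 h2).ne
  unfold sigmaY
  positivity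

/-- First-order Taylor estimate for `z ↦ z ^ Y` along a horizontal segment starting on the
imaginary axis, with a remainder that is uniform in the imaginary part. -/
lemma norm_cpow_taylor_le {Y x : ℝ} {w : ℂ} (h1 : 1 < Y) (h2 : Y < 2) (hx : 0 < x)
    (hre : w.re = 0) (hw : w ≠ 0) :
    ‖((x : ℂ) + w) ^ (Y : ℂ) - w ^ (Y : ℂ) - Y * x * w ^ ((Y - 1 : ℝ) : ℂ)‖ ≤ 7 * x ^ Y := by
  have him : w.im ≠ 0 := fun h => hw (Complex.ext hre h)
  have hnw : 0 < ‖w‖ := norm_pos_iff.2 hw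
  have hxY : x * x ^ (Y - 1) = x ^ Y := by
    rw [← Real.rpow_one_add' hx.le (by linarith)]; congr 1; ring
  rcases le_or_gt ‖w‖ x with h | h
  · have hn : ‖(x : ℂ) + w‖ ≤ 2 * x := by
      refine (norm_add_le _ _).trans ?_
      rw [Complex.norm_real, Real.norm_of_nonneg hx.le]; linarith
    have b1 : ‖((x : ℂ) + w) ^ (Y : ℂ)‖ ≤ 4 * x ^ Y := by
      rw [Complex.norm_cpow_real]
      calc ‖(x : ℂ) + w‖ ^ Y ≤ (2 * x) ^ Y := by gcongr
        _ = 2 ^ Y * x ^ Y := Real.mul_rpow (by norm_num) hx.le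
        _ ≤ 2 ^ (2 : ℝ) * x ^ Y := by gcongr; norm_num
        _ = 4 * x ^ Y := by norm_num
    have b2 : ‖w ^ (Y : ℂ)‖ ≤ x ^ Y := by
      rw [Complex.norm_cpow_real]; gcongr
    have b3 : ‖(Y : ℂ) * x * w ^ ((Y - 1 : ℝ) : ℂ)‖ ≤ 2 * x ^ Y := by
      rw [norm_mul, norm_mul, Complex.norm_cpow_real, Complex.norm_real, Complex.norm_real,
        Real.norm_of_nonneg hx.le, Real.norm_of_nonneg (by linarith : (0 : ℝ) ≤ Y), ← hxY, mul_assoc]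
      gcongr
    have := norm_sub_le (((x : ℂ) + w) ^ (Y : ℂ) - w ^ (Y : ℂ)) (Y * x * w ^ ((Y - 1 : ℝ) : ℂ))
    have := norm_sub_le (((x : ℂ) + w) ^ (Y : ℂ)) (w ^ (Y : ℂ))
    linarith
  · have hslit : ∀ u : ℝ, (u : ℂ) + w ∈ Complex.slitPlane := fun u => by
      right; simpa using him
    have hnorm : ∀ u : ℝ, ‖w‖ ≤ ‖(u : ℂ) + w‖ := fun u => by
      have e : ‖w‖ = |w.im| := by
        rw [← Complex.abs_im_eq_norm.2 hre]
      rw [e]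
      simpa using Complex.abs_im_le_norm ((u : ℂ) + w)
    have hder : ∀ (a u : ℝ), HasDerivAt (fun u : ℝ => ((u : ℂ) + w) ^ (a : ℂ))
        (a * ((u : ℂ) + w) ^ ((a - 1 : ℝ) : ℂ)) u := fun a u => by
      have := ((hasDerivAt_id (u : ℂ)).add_const w).cpow_const (c := (a : ℂ)) (hslit u)
      simpa using this.comp_ofReal
    have hold : ∀ u ∈ Set.Icc (0 : ℝ) x,
        ‖((u : ℂ) + w) ^ ((Y - 1 : ℝ) : ℂ) - w ^ ((Y - 1 : ℝ) : ℂ)‖ ≤ x ^ (Y - 1) := by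
      intro u hu
      have key := Convex.norm_image_sub_le_of_norm_hasDerivWithin_le (𝕜 := ℝ)
        (f := fun u : ℝ => ((u : ℂ) + w) ^ ((Y - 1 : ℝ) : ℂ)) (s := Set.Icc 0 x)
        (C := ‖w‖ ^ (Y - 2)) (x := 0) (y := u)
        (fun z _ => (hder (Y - 1) z).hasDerivWithinAt) (fun z _ => by
          rw [norm_mul, Complex.norm_cpow_real, Complex.norm_real,
            Real.norm_of_nonneg (by linarith : (0 : ℝ) ≤ Y - 1), sub_sub, one_add_one_eq_two]
          have : ‖(z : ℂ) + w‖ ^ (Y - 2) ≤ ‖w‖ ^ (Y - 2) :=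
            Real.rpow_le_rpow_of_nonpos hnw (hnorm z) (by linarith)
          have : 0 ≤ ‖(z : ℂ) + w‖ ^ (Y - 2) := by positivity
          nlinarith) (convex_Icc 0 x) (Set.left_mem_Icc.2 hx.le) hu
      simp only [Complex.ofReal_zero, zero_add, sub_zero] at key
      refine key.trans ?_
      rw [Real.norm_of_nonneg hu.1]
      calc ‖w‖ ^ (Y - 2) * u ≤ x ^ (Y - 2) * x := by
            exact mul_le_mul (Real.rpow_le_rpow_of_nonpos hx h.le (by linarith)) hu.2 hu.1
              (by positivity)
        _ = x ^ (Y - 1) := by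
            rw [← Real.rpow_add_one hx.ne']; congr 1; ring
    have key := Convex.norm_image_sub_le_of_norm_hasDerivWithin_le (𝕜 := ℝ)
        (f := fun u : ℝ => ((u : ℂ) + w) ^ (Y : ℂ) - Y * u * w ^ ((Y - 1 : ℝ) : ℂ))
        (s := Set.Icc 0 x) (C := 2 * x ^ (Y - 1)) (x := 0) (y := x)
        (f' := fun u : ℝ => Y * (((u : ℂ) + w) ^ ((Y - 1 : ℝ) : ℂ) - w ^ ((Y - 1 : ℝ) : ℂ)))
        (fun z _ => by
          have l : HasDerivAt (fun u : ℝ => (Y : ℂ) * u * w ^ ((Y - 1 : ℝ) : ℂ))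
              (Y * 1 * w ^ ((Y - 1 : ℝ) : ℂ)) z :=
            (((hasDerivAt_id (z : ℂ)).const_mul (Y : ℂ)).mul_const _).comp_ofReal
          have := ((hder Y z).sub l).hasDerivWithinAt (s := Set.Icc 0 x)
          refine this.congr_deriv ?_
          ring) (fun z hz => by
          rw [norm_mul, Complex.norm_real, Real.norm_of_nonneg (by linarith : (0 : ℝ) ≤ Y)]
          have := hold z hz
          gcongr) (convex_Icc 0 x) (Set.left_mem_Icc.2 hx.le) (Set.right_mem_Icc.2 hx.le)
    simp only [Complex.ofReal_zero, zero_add, sub_zero, mul_zero, zero_mul] at key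
    rw [Real.norm_of_nonneg hx.le] at key
    rw [sub_right_comm]
    have : 0 ≤ x ^ Y := by positivity
    nlinarith

lemma thetaT_rpow {C G M Y s : ℝ} (hY : Y ≠ 0) (hs : 0 < s) (v : ℝ) :
    thetaT C G M Y (s ^ Y) v =
      Complex.I * (v : ℂ) * ((btilde C G M Y : ℝ) : ℂ) * ((s ^ (Y - 1) : ℝ) : ℂ)
    + ((kappaC C G M Y : ℝ) : ℂ) * ((s ^ Y : ℝ) : ℂ)
    + ((C * Real.Gamma (-Y) : ℝ) : ℂ) *
      (((((M - 1/2) * s : ℝ) : ℂ) + ((v : ℝ) : ℂ) * (-Complex.I)) ^ (Y : ℂ)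
        + ((((G + 1/2) * s : ℝ) : ℂ) + ((v : ℝ) : ℂ) * Complex.I) ^ (Y : ℂ)) := by
  have e1 : (s ^ Y) ^ (1 - 1 / Y) = s ^ (Y - 1) := by
    rw [← Real.rpow_mul hs.le]; congr 1; field_simp
  have e2 : (s ^ Y) ^ (1 / Y) = s := by
    rw [← Real.rpow_mul hs.le, mul_one_div_cancel hY, Real.rpow_one]
  rw [thetaT, e1, e2]
  congr 3
  · ring_nf
  · ring_nf

/-- The scaled exponent minus its stable part and its drift. -/
noncomputable def thetaRem (C G M Y s v : ℝ) : ℂ :=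
  thetaT C G M Y (s ^ Y) v + ((sigmaY C Y * v ^ Y : ℝ) : ℂ)
    - Complex.I * ((btilde C G M Y * s ^ (Y - 1) * v : ℝ) : ℂ)

lemma cpow_mul_I_add {Y v : ℝ} (hv : 0 < v) :
    ((v : ℂ) * (-Complex.I)) ^ (Y : ℂ) + ((v : ℂ) * Complex.I) ^ (Y : ℂ)
      = ((2 * v ^ Y * Real.cos (Real.pi * Y / 2) : ℝ) : ℂ) := by
  have e : Real.cos (Real.pi * Y / 2) = Real.cos (Real.pi / 2 * Y) := by ring_nf
  apply Complex.ext
  · rw [Complex.add_re, Complex.cpow_ofReal_re, Complex.cpow_ofReal_re, Complex.arg_real_mul _ hv,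
      Complex.arg_real_mul _ hv, Complex.arg_neg_I, Complex.arg_I, Complex.ofReal_re, neg_mul,
      Real.cos_neg, e]
    simp [abs_of_pos hv]
    ring
  · rw [Complex.add_im, Complex.cpow_ofReal_im, Complex.cpow_ofReal_im, Complex.arg_real_mul _ hv,
      Complex.arg_real_mul _ hv, Complex.arg_neg_I, Complex.arg_I, Complex.ofReal_im, neg_mul,
      Real.sin_neg]
    simp

/-- The coefficient of `s * v ^ (Y - 1)` in the real part of `thetaRem`. -/
noncomputable def skewCoeff (C G M Y : ℝ) : ℝ :=
  C * Real.Gamma (-Y) * Y * ((M - 1/2) + (G + 1/2)) * Real.sin (Y * Real.pi / 2)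

lemma thetaRem_bounds {C G M Y : ℝ} (hC : 0 < C) (hG : 0 ≤ G) (hM : 1 < M)
    (h1 : 1 < Y) (h2 : Y < 2) : ∃ K : ℝ, 0 ≤ K ∧ ∀ s v : ℝ, 0 < s → 0 < v →
      ‖thetaRem C G M Y s v‖ ≤ K * (s * v ^ (Y - 1) + s ^ Y) ∧
      |(thetaRem C G M Y s v).re - skewCoeff C G M Y * s * v ^ (Y - 1)| ≤ K * s ^ Y := by
  set A := C * Real.Gamma (-Y) with hA
  have hA0 : 0 < A := mul_pos hC (Real.Gamma_neg_pos_of_mem_Ioo h1 h2)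
  set K₁ := |kappaC C G M Y| + A * (7 * (M - 1/2) ^ Y + 7 * (G + 1/2) ^ Y) with hK₁
  set K₂ := A * Y * ((M - 1/2) + (G + 1/2)) with hK₂
  have hK₁0 : 0 ≤ K₁ := by
    have : 0 ≤ M - 1/2 := by linarith
    positivity
  have hK₂0 : 0 ≤ K₂ := by
    have : 0 ≤ M - 1/2 := by linarith
    positivity
  refine ⟨K₁ + K₂, by positivity, fun s v hs hv => ?_⟩
  set w₁ : ℂ := (v : ℂ) * (-Complex.I)
  set w₂ : ℂ := (v : ℂ) * Complex.I
  set S : ℂ := (A : ℂ) * (Y * ((M - 1/2) * s : ℝ) * w₁ ^ ((Y - 1 : ℝ) : ℂ)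
    + Y * ((G + 1/2) * s : ℝ) * w₂ ^ ((Y - 1 : ℝ) : ℂ)) with hS
  have hv' : (v : ℂ) ≠ 0 := by exact_mod_cast hv.ne'
  have hm₁ : 0 < (M - 1/2) * s := mul_pos (by linarith) hs
  have hm₂ : 0 < (G + 1/2) * s := mul_pos (by linarith) hs
  have t₁ := norm_cpow_taylor_le (w := w₁) h1 h2 hm₁ (by simp [w₁]) (by simp [w₁, hv'])
  have t₂ := norm_cpow_taylor_le (w := w₂) h1 h2 hm₂ (by simp [w₂]) (by simp [w₂, hv'])
  rw [Real.mul_rpow (by linarith) hs.le] at t₁ t₂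
  have hdiff : thetaRem C G M Y s v - S = (kappaC C G M Y : ℂ) * ((s ^ Y : ℝ) : ℂ)
      + A * ((((M - 1/2) * s : ℝ) + w₁) ^ (Y : ℂ) - w₁ ^ (Y : ℂ)
            - Y * ((M - 1/2) * s : ℝ) * w₁ ^ ((Y - 1 : ℝ) : ℂ)
        + ((((G + 1/2) * s : ℝ) + w₂) ^ (Y : ℂ) - w₂ ^ (Y : ℂ)
            - Y * ((G + 1/2) * s : ℝ) * w₂ ^ ((Y - 1 : ℝ) : ℂ))) := by
    have hsum := cpow_mul_I_add (Y := Y) hv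
    have hst : ((sigmaY C Y * v ^ Y : ℝ) : ℂ) = -(A : ℂ) * (w₁ ^ (Y : ℂ) + w₂ ^ (Y : ℂ)) := by
      rw [hsum, sigmaY_eq h1 h2, ← hA]
      push_cast
      ring
    have hT : thetaT C G M Y (s ^ Y) v =
        Complex.I * (v : ℂ) * (btilde C G M Y : ℂ) * ((s ^ (Y - 1) : ℝ) : ℂ)
        + (kappaC C G M Y : ℂ) * ((s ^ Y : ℝ) : ℂ)
        + (A : ℂ) * ((((M - 1/2) * s : ℝ) + w₁) ^ (Y : ℂ) + (((G + 1/2) * s : ℝ) + w₂) ^ (Y : ℂ)) :=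
      thetaT_rpow (by linarith) hs v
    rw [thetaRem, hT, hst, hS, Complex.ofReal_mul (_ * _) v, Complex.ofReal_mul (btilde C G M Y)]
    ring
  have hrem : ‖thetaRem C G M Y s v - S‖ ≤ K₁ * s ^ Y := by
    rw [hdiff]
    refine (norm_add_le _ _).trans ?_
    rw [norm_mul, norm_mul, Complex.norm_real, Complex.norm_real, Complex.norm_real,
      Real.norm_of_nonneg hA0.le, Real.norm_eq_abs, Real.norm_of_nonneg (by positivity : 0 ≤ s ^ Y)]
    have := (norm_add_le _ _).trans (add_le_add t₁ t₂)
    have := mul_le_mul_of_nonneg_left this hA0.le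
    rw [hK₁]
    linarith
  have hsY : 0 ≤ s ^ Y := by positivity
  have hvY : 0 ≤ s * v ^ (Y - 1) := by positivity
  have hnw₁ : ‖w₁‖ = v := by simp [w₁, abs_of_pos hv]
  have hnw₂ : ‖w₂‖ = v := by simp [w₂, abs_of_pos hv]
  constructor
  · have hSn : ‖S‖ ≤ K₂ * (s * v ^ (Y - 1)) := by
      rw [hS, norm_mul, Complex.norm_real, Real.norm_of_nonneg hA0.le]
      have := norm_add_le ((Y : ℂ) * ((M - 1/2) * s : ℝ) * w₁ ^ ((Y - 1 : ℝ) : ℂ))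
        ((Y : ℂ) * ((G + 1/2) * s : ℝ) * w₂ ^ ((Y - 1 : ℝ) : ℂ))
      rw [norm_mul, norm_mul, norm_mul, norm_mul, Complex.norm_cpow_real, Complex.norm_cpow_real,
        Complex.norm_real, Complex.norm_real, Complex.norm_real, hnw₁, hnw₂,
        Real.norm_of_nonneg hm₁.le, Real.norm_of_nonneg hm₂.le,
        Real.norm_of_nonneg (by linarith : 0 ≤ Y)] at this
      have := mul_le_mul_of_nonneg_left this hA0.le
      rw [hK₂]
      linarith
    have := norm_add_le (thetaRem C G M Y s v - S) S
    rw [sub_add_cancel] at this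
    nlinarith
  · have hre : S.re = skewCoeff C G M Y * s * v ^ (Y - 1) := by
      have e : Real.cos (Real.pi / 2 * (Y - 1)) = Real.sin (Y * Real.pi / 2) := by
        rw [← Real.cos_sub_pi_div_two]; congr 1; ring
      have r₁ : (w₁ ^ ((Y - 1 : ℝ) : ℂ)).re = v ^ (Y - 1) * Real.sin (Y * Real.pi / 2) := by
        rw [Complex.cpow_ofReal_re, hnw₁, Complex.arg_real_mul _ hv, Complex.arg_neg_I, neg_mul,
          Real.cos_neg, e]
      have r₂ : (w₂ ^ ((Y - 1 : ℝ) : ℂ)).re = v ^ (Y - 1) * Real.sin (Y * Real.pi / 2) := by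
        rw [Complex.cpow_ofReal_re, hnw₂, Complex.arg_real_mul _ hv, Complex.arg_I, e]
      rw [hS, skewCoeff, ← hA, ← Complex.ofReal_mul, ← Complex.ofReal_mul, Complex.re_ofReal_mul,
        Complex.add_re, Complex.re_ofReal_mul, Complex.re_ofReal_mul, r₁, r₂]
      ring
    rw [← hre, ← Complex.sub_re]
    refine (Complex.abs_re_le_norm _).trans (hrem.trans ?_)
    nlinarith

/-! ### Pointwise expansion of the integrand -/

lemma Real.abs_cos_sub_quartic_le (x : ℝ) :
    |Real.cos x - (1 - x ^ 2 / 2 + x ^ 4 / 24)| ≤ 3 * x ^ 6 := by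
  rcases le_or_gt |x| 1 with h | h
  · have hx : ‖(x : ℂ) * Complex.I‖ ≤ 1 := by simpa using h
    have hb := Complex.exp_bound hx (n := 6) (by norm_num)
    have hre := (Complex.abs_re_le_norm _).trans hb
    have e : (Complex.exp (x * Complex.I)
        - ∑ m ∈ Finset.range 6, ((x : ℂ) * Complex.I) ^ m / (m.factorial : ℂ)).re
        = Real.cos x - (1 - x ^ 2 / 2 + x ^ 4 / 24) := by
      have i3 : Complex.I ^ 3 = -Complex.I := Complex.I_pow_three
      have i5 : Complex.I ^ 5 = Complex.I := by
        rw [show 5 = 4 + 1 from rfl, pow_add, Complex.I_pow_four, one_mul, pow_one]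
      rw [Complex.sub_re, Complex.exp_ofReal_mul_I_re]
      congr 1
      have : ∑ m ∈ Finset.range 6, ((x : ℂ) * Complex.I) ^ m / (m.factorial : ℂ)
          = ((1 - x ^ 2 / 2 + x ^ 4 / 24 : ℝ) : ℂ)
            + ((x - x ^ 3 / 6 + x ^ 5 / 120 : ℝ) : ℂ) * Complex.I := by
        simp only [Finset.sum_range_succ, Finset.sum_range_zero, mul_pow, i3, i5, Complex.I_sq,
          Complex.I_pow_four, Nat.factorial]
        push_cast
        ring
      rw [this, Complex.add_re, Complex.ofReal_re, Complex.re_ofReal_mul, Complex.I_re, mul_zero,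
        add_zero]
    rw [e] at hre
    refine hre.trans ?_
    have : ‖(x : ℂ) * Complex.I‖ ^ 6 = x ^ 6 := by
      rw [norm_mul, Complex.norm_I, mul_one, Complex.norm_real, Real.norm_eq_abs,
        Even.pow_abs (by decide)]
    rw [this]
    have : 0 ≤ x ^ 6 := by positivity
    norm_num [Nat.factorial]
    linarith
  · have h2 : 1 ≤ x ^ 2 := by
      rw [← sq_abs]; nlinarith
    have h4 : x ^ 2 ≤ x ^ 4 := by nlinarith
    have h6 : x ^ 4 ≤ x ^ 6 := by nlinarith
    have := Real.cos_le_one x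
    have := Real.neg_one_le_cos x
    rw [abs_le]
    constructor <;> linarith

lemma Complex.norm_exp_sub_one_sub_id_le_sq_mul_exp (z : ℂ) :
    ‖1 + z - Complex.exp z‖ ≤ ‖z‖ ^ 2 * Real.exp ‖z‖ := by
  have := Complex.norm_exp_sub_sum_le_norm_mul_exp z 2
  rw [norm_sub_rev]
  simpa [Finset.sum_range_succ] using this

lemma rpow_ge_of_le_one_of_le_sq {a y p : ℝ} (hy : 0 < y) (h1 : a ≤ 1) (h2 : a ≤ y ^ 2)
    (hp0 : 0 ≤ p) (hp2 : p ≤ 2) : a ≤ y ^ p := by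
  rcases le_total y 1 with h | h
  · refine h2.trans ?_
    rw [← Real.rpow_two]
    exact Real.rpow_le_rpow_of_exponent_ge hy h hp2
  · exact h1.trans (Real.one_le_rpow h hp0)

/-- The exponential decay beats every power between `Y` and `6`. -/
lemma rpow_mul_exp_neg_le {c Y p v : ℝ} (hc : 0 < c) (h1 : 1 < Y) (hp : Y ≤ p) (hp6 : p ≤ 6)
    (hv : 0 < v) :
    v ^ p * Real.exp (-c * v ^ Y) ≤ (1 + 720 / c ^ 6) * min 1 (v ^ Y) := by
  have hK : 0 ≤ 720 / c ^ 6 := by positivity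
  have hvY : 0 < v ^ Y := by positivity
  rcases le_total v 1 with h | h
  · have hm : min 1 (v ^ Y) = v ^ Y := min_eq_right (Real.rpow_le_one hv.le h (by linarith))
    rw [hm]
    have a1 : v ^ p ≤ v ^ Y := Real.rpow_le_rpow_of_exponent_ge hv h hp
    have a2 : Real.exp (-c * v ^ Y) ≤ 1 := Real.exp_le_one_iff.2 (by nlinarith)
    have a3 : 0 < Real.exp (-c * v ^ Y) := Real.exp_pos _
    have : 0 < v ^ p := by positivity
    nlinarith
  · have hm : min 1 (v ^ Y) = 1 := min_eq_left (Real.one_le_rpow h (by linarith))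
    rw [hm, mul_one]
    have a1 : v ^ p ≤ (v ^ Y) ^ 6 := by
      rw [← Real.rpow_natCast (v ^ Y), ← Real.rpow_mul hv.le]
      exact Real.rpow_le_rpow_of_exponent_le h (by push_cast; linarith)
    have a2 := Real.pow_div_factorial_le_exp (c * v ^ Y) (by positivity) 6
    have a3 : Real.exp (c * v ^ Y) * Real.exp (-c * v ^ Y) = 1 := by
      rw [← Real.exp_add]; simp
    have a4 : (v ^ Y) ^ 6 ≤ 720 / c ^ 6 * Real.exp (c * v ^ Y) := by
      rw [mul_pow] at a2
      norm_num [Nat.factorial] at a2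
      rw [div_mul_eq_mul_div, le_div_iff₀ (by positivity)]
      linarith
    have := Real.exp_pos (-c * v ^ Y)
    calc v ^ p * Real.exp (-c * v ^ Y)
        ≤ 720 / c ^ 6 * Real.exp (c * v ^ Y) * Real.exp (-c * v ^ Y) := by
          gcongr; exact a1.trans a4
      _ = 720 / c ^ 6 := by rw [mul_assoc, a3, mul_one]
      _ ≤ _ := by linarith

lemma mul_rpow_sub_one_le {K σ Y v : ℝ} (hK : 0 ≤ K) (hσ : 0 < σ) (h1 : 1 < Y) (hv : 0 < v) :
    K * v ^ (Y - 1) ≤ σ / 2 * v ^ Y + K * (2 * K / σ) ^ (Y - 1) := by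
  rcases le_total (2 * K / σ) v with h | h
  · have e : v ^ Y = v * v ^ (Y - 1) := by
      rw [← Real.rpow_one_add' hv.le (by linarith)]; congr 1; ring
    rw [div_le_iff₀ hσ] at h
    have : 0 ≤ v ^ (Y - 1) := by positivity
    have : 0 ≤ K * (2 * K / σ) ^ (Y - 1) := by positivity
    rw [e]
    nlinarith
  · have : v ^ (Y - 1) ≤ (2 * K / σ) ^ (Y - 1) := Real.rpow_le_rpow hv.le h (by linarith)
    have := mul_le_mul_of_nonneg_left this hK
    have : 0 ≤ σ / 2 * v ^ Y := by positivity
    linarith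

lemma one_sub_exp_neg_le_min {σ x : ℝ} (hσ : 0 < σ) (hx : 0 ≤ x) :
    1 - Real.exp (-σ * x) ≤ (1 + σ) * min 1 x := by
  have a1 := Real.add_one_le_exp (-σ * x)
  have a2 := Real.exp_pos (-σ * x)
  rcases min_cases 1 x with ⟨h, _⟩ | ⟨h, _⟩ <;> rw [h] <;> nlinarith

lemma exp_neg_sub_one_add_nonneg (x : ℝ) : 0 ≤ Real.exp (-x) - 1 + x := by
  linarith [Real.add_one_le_exp (-x)]

lemma exp_neg_sub_one_add_le {σ x : ℝ} (hσ : 0 < σ) (hx : 0 ≤ x) :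
    Real.exp (-σ * x) - 1 + σ * x ≤ (σ + σ ^ 2) * (x * min 1 x) := by
  have a2 : Real.exp (-σ * x) ≤ 1 := Real.exp_le_one_iff.2 (by nlinarith)
  have a3 : Real.exp (-σ * x) - 1 + σ * x ≤ (σ * x) ^ 2 := by
    have hb := Real.add_one_le_exp (σ * x)
    have h0 : 0 ≤ σ * x := by positivity
    have hinv : Real.exp (-σ * x) ≤ 1 / (1 + σ * x) := by
      rw [neg_mul, Real.exp_neg, inv_eq_one_div]
      apply one_div_le_one_div_of_le <;> linarith
    have : 1 / (1 + σ * x) ≤ 1 - σ * x + (σ * x) ^ 2 := by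
      rw [div_le_iff₀ (by linarith)]
      nlinarith [pow_nonneg h0 3]
    linarith
  have : 0 ≤ σ ^ 2 * x := by positivity
  rcases min_cases 1 x with ⟨h, _⟩ | ⟨h, _⟩ <;> rw [h] <;> nlinarith [mul_nonneg hσ.le (mul_nonneg hx hx)]

/-- Splitting of the real part of `1 - exp` into the contributions that are expanded separately. -/
lemma one_sub_exp_re_split (a x : ℝ) (R : ℂ) :
    (1 - Complex.exp (((-a : ℝ) : ℂ) + Complex.I * (x : ℂ) + R)).re
      = (1 - Real.exp (-a)) + Real.exp (-a) * (1 - Real.cos x) - R.re + (1 - Real.exp (-a)) * R.re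
        + Real.exp (-a) * ((1 - Complex.exp (Complex.I * x)) * R).re
        + Real.exp (-a) * (Complex.exp (Complex.I * x) * (1 + R - Complex.exp R)).re := by
  have hcos : (Complex.exp (Complex.I * x)).re = Real.cos x := by
    rw [mul_comm, Complex.exp_ofReal_mul_I_re]
  rw [← hcos, Complex.exp_add, Complex.exp_add, ← Complex.ofReal_exp]
  set E := Real.exp (-a)
  set q := Complex.exp (Complex.I * x)
  have : (1 : ℂ) - E * q * Complex.exp R
      = ((1 - E : ℝ) : ℂ) + (E : ℂ) * (1 - q) - R + ((1 - E : ℝ) : ℂ) * R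
        + (E : ℂ) * ((1 - q) * R) + (E : ℂ) * (q * (1 + R - Complex.exp R)) := by
    push_cast
    ring
  rw [this]
  simp only [Complex.add_re, Complex.sub_re, Complex.re_ofReal_mul, Complex.ofReal_re,
    Complex.one_re]

set_option maxHeartbeats 400000 in
lemma integrand_expansion {σ b c K Y : ℝ} (hσ : 0 < σ) (hK : 0 ≤ K) (h1 : 1 < Y) (h2 : Y < 2) :
    ∃ K' : ℝ, 0 ≤ K' ∧ ∀ s v : ℝ, 0 < s → s ≤ 1 → 0 < v → ∀ R : ℂ,
      ‖R‖ ≤ K * (s * v ^ (Y - 1) + s ^ Y) → |R.re - c * s * v ^ (Y - 1)| ≤ K * s ^ Y →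
      |v ^ 2 / (v ^ 2 + s ^ 2 / 4) * (1 - Complex.exp (((-(σ * v ^ Y) : ℝ) : ℂ)
            + Complex.I * ((b * s ^ (Y - 1) * v : ℝ) : ℂ) + R)).re
        - ((1 - Real.exp (-(σ * v ^ Y)))
          + (-(σ * v ^ Y) - v ^ 2 / (v ^ 2 + s ^ 2 / 4) * (-(σ * v ^ Y) + R.re))
          + Real.exp (-(σ * v ^ Y))
            * ((b * s ^ (Y - 1) * v) ^ 2 / 2 - (b * s ^ (Y - 1) * v) ^ 4 / 24)
          + (1 - Real.exp (-(σ * v ^ Y))) * (c * s * v ^ (Y - 1)))|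
      ≤ K' * (s ^ Y + s ^ (6 * Y - 6)) * min 1 (v ^ Y) := by
  set κ := 1 + 720 / σ ^ 6 with hκ
  set κ' := 1 + 720 / (σ / 2) ^ 6 with hκ'
  set D := Real.exp (K + K * (2 * K / σ) ^ (Y - 1)) with hD
  set L := (σ + σ ^ 2) + 3 * b ^ 6 * κ + (b ^ 2 / 2 * κ + b ^ 4 / 24 * κ) + (1 + σ) * (K + |c|)
    + 5 * |b| * K * κ + 16 * K ^ 2 * D * κ' with hL
  have hκ0 : 0 ≤ κ := by positivity
  have hκ'0 : 0 ≤ κ' := by positivity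
  refine ⟨L, by positivity, fun s v hs hs1 hv R hR hRre => ?_⟩
  set S := s ^ Y with hS
  set V := v ^ Y with hV
  have hS0 : 0 < S := by positivity
  have hV0 : 0 < V := by positivity
  have hs1' : s ^ (Y - 1) = S / s := by rw [Real.rpow_sub_one hs.ne']
  have hv1' : v ^ (Y - 1) = V / v := by rw [Real.rpow_sub_one hv.ne']
  have hSs : S / s ≤ 1 := hs1' ▸ Real.rpow_le_one hs.le hs1 (by linarith)
  have hU : s ^ (6 * Y - 6) = (S / s) ^ 6 := by
    rw [← hs1', ← Real.rpow_natCast, ← Real.rpow_mul hs.le]; congr 1; push_cast; ring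
  have hS1 : S ≤ 1 := Real.rpow_le_one hs.le hs1 (by linarith)
  rw [hs1', hv1', hU]
  rw [hv1'] at hR hRre
  set m := min 1 V with hm
  have hm0 : 0 ≤ m := by positivity
  set ρ := v ^ 2 / (v ^ 2 + s ^ 2 / 4) with hρ
  have hρ0 : 0 ≤ ρ := by positivity
  have hρ1 : ρ ≤ 1 := div_le_one_of_le₀ (le_add_of_nonneg_right (by positivity)) (by positivity)
  have hρc : 1 - ρ ≤ (s / v) ^ 2 := by
    have : 1 - ρ = s ^ 2 / (4 * v ^ 2 + s ^ 2) := by rw [hρ]; field_simp; ring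
    rw [this, div_pow]
    gcongr
    linarith only [sq_nonneg s, sq_nonneg v]
  have hρc2 : ρ / 4 ≤ (v / s) ^ 2 := by
    have : ρ / 4 = v ^ 2 / (4 * v ^ 2 + s ^ 2) := by rw [hρ]; field_simp
    rw [this, div_pow]
    gcongr
    linarith only [sq_nonneg s, sq_nonneg v]
  have hc : ∀ p : ℝ, 0 ≤ p → p ≤ 2 → 1 - ρ ≤ s ^ p / v ^ p := fun p hp0 hp2 => by
    rw [← Real.div_rpow hs.le hv.le]
    exact rpow_ge_of_le_one_of_le_sq (by positivity) (by linarith) hρc hp0 hp2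
  have hr : ∀ p : ℝ, 0 ≤ p → p ≤ 2 → ρ ≤ 4 * (v ^ p / s ^ p) := fun p hp0 hp2 => by
    rw [← Real.div_rpow hv.le hs.le]
    linarith [rpow_ge_of_le_one_of_le_sq (by positivity : 0 < v / s) (by linarith) hρc2 hp0 hp2]
  have hs2' : s ^ (2 - Y) = s ^ 2 / S := by rw [Real.rpow_sub hs, Real.rpow_two]
  have hv2' : v ^ (2 - Y) = v ^ 2 / V := by rw [Real.rpow_sub hv, Real.rpow_two]
  have c0 := hc Y (by linarith) h2.le
  have c1 := hc (Y - 1) (by linarith) (by linarith)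
  have c2 := hc (2 - Y) (by linarith) (by linarith)
  have r0 := hr Y (by linarith) h2.le
  have r1 := hr (Y - 1) (by linarith) (by linarith)
  have r2 := hr (2 - Y) (by linarith) (by linarith)
  rw [hs1', hv1'] at c1 r1
  rw [hs2', hv2'] at c2 r2
  have hρ' : 0 ≤ 1 - ρ := by linarith
  have hE := fun p hp hp6 => rpow_mul_exp_neg_le (p := p) (c := σ) hσ h1 hp hp6 hv
  have hE2 := rpow_mul_exp_neg_le (p := Y) (c := σ / 2) (by positivity) h1 le_rfl (by linarith) hv
  simp only [neg_mul, ← hκ, ← hκ', ← hV, ← hm] at hE hE2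
  have g1 := one_sub_exp_neg_le_min hσ hV0.le
  have g2 := exp_neg_sub_one_add_le hσ hV0.le
  have g3 := exp_neg_sub_one_add_nonneg (σ * V)
  rw [neg_mul, ← hm] at g1 g2
  rw [one_sub_exp_re_split]
  set E := Real.exp (-(σ * V)) with hEdef
  have hE0 : 0 < E := Real.exp_pos _
  have hE1 : E ≤ 1 := Real.exp_le_one_iff.2 (neg_nonpos.2 (by positivity))
  have eY : V * E ≤ κ * m := hE Y le_rfl (by linarith)
  have eY2 : v ^ 2 * V * E ≤ κ * m := by
    have := hE (Y + 2) (by linarith) (by linarith)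
    rwa [Real.rpow_add hv, Real.rpow_two, mul_comm (v ^ Y)] at this
  have e6 : v ^ 6 * E ≤ κ * m := by
    have := hE 6 (by linarith) le_rfl
    rwa [show (6 : ℝ) = ((6 : ℕ) : ℝ) by norm_num, Real.rpow_natCast] at this
  set x := b * (S / s) * v with hx
  have hU0 : 0 < (S / s) ^ 6 := by positivity
  -- the correction of the stable part
  have B1 : |(1 - ρ) * (E - 1 + σ * V)| ≤ (σ + σ ^ 2) * S * m := by
    rw [abs_of_nonneg (by positivity)]
    calc (1 - ρ) * (E - 1 + σ * V) ≤ (S / V) * ((σ + σ ^ 2) * (V * m)) := by gcongr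
      _ = _ := by field_simp
  -- the remainder of the cosine
  have B2 : |ρ * E * (1 - Real.cos x - x ^ 2 / 2 + x ^ 4 / 24)| ≤ 3 * b ^ 6 * κ * (S / s) ^ 6 * m := by
    have hcos := Real.abs_cos_sub_quartic_le x
    rw [abs_mul, abs_mul, abs_of_nonneg hρ0, abs_of_pos hE0,
      show 1 - Real.cos x - x ^ 2 / 2 + x ^ 4 / 24 = -(Real.cos x - (1 - x ^ 2 / 2 + x ^ 4 / 24)) by
        ring, abs_neg]
    calc ρ * E * |Real.cos x - (1 - x ^ 2 / 2 + x ^ 4 / 24)| ≤ 1 * E * (3 * x ^ 6) := by gcongr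
      _ = 3 * b ^ 6 * (S / s) ^ 6 * (v ^ 6 * E) := by rw [hx]; ring
      _ ≤ 3 * b ^ 6 * (S / s) ^ 6 * (κ * m) := by gcongr
      _ = _ := by ring
  have hx2 : (1 - ρ) * x ^ 2 ≤ b ^ 2 * S * V := by
    calc (1 - ρ) * x ^ 2 ≤ s ^ 2 / S / (v ^ 2 / V) * x ^ 2 := by gcongr
      _ = _ := by rw [hx]; field_simp
  have hx2' : x ^ 2 ≤ b ^ 2 * v ^ 2 := by
    have : (S / s) ^ 2 ≤ 1 := pow_le_one₀ (by positivity) hSs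
    calc x ^ 2 = b ^ 2 * v ^ 2 * (S / s) ^ 2 := by rw [hx]; ring
      _ ≤ b ^ 2 * v ^ 2 * 1 := by gcongr
      _ = _ := mul_one _
  have B3 : |(1 - ρ) * E * (x ^ 2 / 2 - x ^ 4 / 24)|
      ≤ (b ^ 2 / 2 * κ + b ^ 4 / 24 * κ) * S * m := by
    calc |(1 - ρ) * E * (x ^ 2 / 2 - x ^ 4 / 24)|
        = |(1 - ρ) * x ^ 2 * E / 2 - (1 - ρ) * x ^ 2 * x ^ 2 * E / 24| := by congr 1; ring
      _ ≤ |(1 - ρ) * x ^ 2 * E / 2| + |(1 - ρ) * x ^ 2 * x ^ 2 * E / 24| := abs_sub _ _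
      _ = (1 - ρ) * x ^ 2 * E / 2 + (1 - ρ) * x ^ 2 * x ^ 2 * E / 24 := by
          rw [abs_of_nonneg (by positivity), abs_of_nonneg (by positivity)]
      _ ≤ b ^ 2 * S * V * E / 2 + b ^ 2 * S * V * (b ^ 2 * v ^ 2) * E / 24 := by gcongr
      _ = b ^ 2 / 2 * S * (V * E) + b ^ 4 / 24 * S * (v ^ 2 * V * E) := by ring
      _ ≤ b ^ 2 / 2 * S * (κ * m) + b ^ 4 / 24 * S * (κ * m) := by gcongr
      _ = _ := by ring
  have B4 : |(1 - E) * (ρ * (R.re - c * s * (V / v)) - (1 - ρ) * (c * s * (V / v)))|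
      ≤ (1 + σ) * (K + |c|) * S * m := by
    rw [abs_mul, abs_of_nonneg (by linarith : 0 ≤ 1 - E)]
    have i1 : |ρ * (R.re - c * s * (V / v))| ≤ K * S := by
      rw [abs_mul, abs_of_nonneg hρ0]
      calc _ ≤ 1 * (K * S) := by gcongr
        _ = _ := one_mul _
    have i2 : |(1 - ρ) * (c * s * (V / v))| ≤ |c| * S := by
      rw [abs_mul, abs_of_nonneg hρ', mul_assoc, abs_mul,
        abs_of_nonneg (by positivity : 0 ≤ s * (V / v))]
      calc _ ≤ S / s / (V / v) * (|c| * (s * (V / v))) := by gcongr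
        _ = _ := by field_simp
    calc _ ≤ (1 + σ) * m * (K * S + |c| * S) := by
          gcongr
          exact (abs_sub _ _).trans (add_le_add i1 i2)
      _ = _ := by ring
  have hxabs : |x| = |b| * (S / s) * v := by
    rw [hx, abs_mul, abs_mul, abs_of_pos hv, abs_of_nonneg (by positivity : 0 ≤ S / s)]
  have B5 : |ρ * (E * ((1 - Complex.exp (Complex.I * x)) * R).re)| ≤ 5 * |b| * K * κ * S * m := by
    rw [abs_mul, abs_mul, abs_of_nonneg hρ0, abs_of_pos hE0]
    have i1 : |((1 - Complex.exp (Complex.I * x)) * R).re| ≤ |x| * (K * (s * (V / v) + S)) := by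
      refine (Complex.abs_re_le_norm _).trans ?_
      rw [norm_mul, norm_sub_rev]
      gcongr
      exact Real.norm_exp_I_mul_ofReal_sub_one_le
    calc _ ≤ ρ * (E * (|x| * (K * (s * (V / v) + S)))) := by gcongr
      _ = |b| * K * E * (ρ * S * V + ρ * (S / s) * v * S) := by rw [hxabs]; field_simp
      _ ≤ |b| * K * E * (1 * S * V + 4 * (V / v / (S / s)) * (S / s) * v * S) := by gcongr
      _ = 5 * |b| * K * S * (V * E) := by field_simp; ring
      _ ≤ 5 * |b| * K * S * (κ * m) := by gcongr
      _ = _ := by ring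
  have B6 : |ρ * (E * (Complex.exp (Complex.I * x) * (1 + R - Complex.exp R)).re)|
      ≤ 16 * K ^ 2 * D * κ' * S * m := by
    rw [abs_mul, abs_mul, abs_of_nonneg hρ0, abs_of_pos hE0]
    have i1 : |(Complex.exp (Complex.I * x) * (1 + R - Complex.exp R)).re|
        ≤ ‖R‖ ^ 2 * Real.exp ‖R‖ := by
      refine (Complex.abs_re_le_norm _).trans ?_
      rw [norm_mul, Complex.norm_exp_I_mul_ofReal, one_mul]
      exact Complex.norm_exp_sub_one_sub_id_le_sq_mul_exp R
    have i2 : ρ * ‖R‖ ^ 2 ≤ 16 * K ^ 2 * S * V := by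
      calc ρ * ‖R‖ ^ 2 ≤ ρ * (K * (s * (V / v) + S)) ^ 2 := by gcongr
        _ ≤ ρ * (K ^ 2 * (2 * ((s * (V / v)) ^ 2 + S ^ 2))) := by
            rw [mul_pow]
            gcongr
            exact add_sq_le
        _ = 2 * K ^ 2 * (ρ * (s * (V / v)) ^ 2 + ρ * S ^ 2) := by ring
        _ ≤ 2 * K ^ 2 * (4 * (v ^ 2 / V / (s ^ 2 / S)) * (s * (V / v)) ^ 2
              + 4 * (V / S) * S ^ 2) := by gcongr
        _ = _ := by field_simp; ring
    have i3 : E * Real.exp ‖R‖ ≤ D * Real.exp (-(σ / 2 * V)) := by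
      rw [hEdef, hD, ← Real.exp_add, ← Real.exp_add, Real.exp_le_exp]
      have j1 := mul_rpow_sub_one_le hK hσ h1 hv
      rw [hv1', ← hV] at j1
      have j2 : K * (s * (V / v) + S) ≤ K * (V / v + 1) := by
        gcongr
        exact mul_le_of_le_one_left (by positivity) hs1
      linarith only [j1, j2, hR]
    calc _ ≤ ρ * (E * (‖R‖ ^ 2 * Real.exp ‖R‖)) := by gcongr
      _ = ρ * ‖R‖ ^ 2 * (E * Real.exp ‖R‖) := by ring
      _ ≤ 16 * K ^ 2 * S * V * (D * Real.exp (-(σ / 2 * V))) := by gcongr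
      _ = 16 * K ^ 2 * D * S * (V * Real.exp (-(σ / 2 * V))) := by ring
      _ ≤ 16 * K ^ 2 * D * S * (κ' * m) := by gcongr
      _ = _ := by ring
  set P := ((1 - Complex.exp (Complex.I * x)) * R).re
  set Q := (Complex.exp (Complex.I * x) * (1 + R - Complex.exp R)).re
  have split : ρ * ((1 - E) + E * (1 - Real.cos x) - R.re + (1 - E) * R.re + E * P + E * Q)
      - ((1 - E) + (-(σ * V) - ρ * (-(σ * V) + R.re)) + E * (x ^ 2 / 2 - x ^ 4 / 24)
        + (1 - E) * (c * s * (V / v)))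
      = (1 - ρ) * (E - 1 + σ * V) + ρ * E * (1 - Real.cos x - x ^ 2 / 2 + x ^ 4 / 24)
        - (1 - ρ) * E * (x ^ 2 / 2 - x ^ 4 / 24)
        + (1 - E) * (ρ * (R.re - c * s * (V / v)) - (1 - ρ) * (c * s * (V / v)))
        + ρ * (E * P) + ρ * (E * Q) := by ring
  rw [split]
  have tot : |(1 - ρ) * (E - 1 + σ * V) + ρ * E * (1 - Real.cos x - x ^ 2 / 2 + x ^ 4 / 24)
        - (1 - ρ) * E * (x ^ 2 / 2 - x ^ 4 / 24)
        + (1 - E) * (ρ * (R.re - c * s * (V / v)) - (1 - ρ) * (c * s * (V / v)))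
        + ρ * (E * P) + ρ * (E * Q)|
      ≤ (σ + σ ^ 2) * S * m + 3 * b ^ 6 * κ * (S / s) ^ 6 * m
        + (b ^ 2 / 2 * κ + b ^ 4 / 24 * κ) * S * m + (1 + σ) * (K + |c|) * S * m
        + 5 * |b| * K * κ * S * m + 16 * K ^ 2 * D * κ' * S * m := by
    refine (abs_add_le _ _).trans (add_le_add ((abs_add_le _ _).trans (add_le_add
      ((abs_add_le _ _).trans (add_le_add ((abs_sub _ _).trans (add_le_add
        ((abs_add_le _ _).trans (add_le_add B1 B2)) B3)) B4)) B5)) B6)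
  refine tot.trans ?_
  have n1 : 0 ≤ (L - 3 * b ^ 6 * κ) * ((S / s) ^ 6 * m) := by
    refine mul_nonneg ?_ (by positivity)
    have : L - 3 * b ^ 6 * κ = (σ + σ ^ 2) + (b ^ 2 / 2 * κ + b ^ 4 / 24 * κ) + (1 + σ) * (K + |c|)
      + 5 * |b| * K * κ + 16 * K ^ 2 * D * κ' := by rw [hL]; ring
    rw [this]
    positivity
  have n2 : 0 ≤ 3 * b ^ 6 * κ * (S * m) := by positivity
  calc _ ≤ _ := le_add_of_nonneg_right (add_nonneg n1 n2)
    _ = L * (S + (S / s) ^ 6) * m := by rw [hL]; ring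

/-! ### Integrals -/

lemma integrableOn_Ioi_zero_of_norm_le_rpow {E : Type*} [NormedAddCommGroup E] {f : ℝ → E}
    {a b K : ℝ} (ha : -1 < a) (hb : b < -1)
    (hf : AEStronglyMeasurable f (volume.restrict (Set.Ioi 0)))
    (h0 : ∀ v, 0 < v → v ≤ 1 → ‖f v‖ ≤ K * v ^ a) (h1 : ∀ v, 1 < v → ‖f v‖ ≤ K * v ^ b) :
    IntegrableOn f (Set.Ioi 0) := by
  rw [← Set.Ioc_union_Ioi_eq_Ioi (zero_le_one' ℝ)]
  refine IntegrableOn.union ?_ ?_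
  · have hi : IntegrableOn (fun v : ℝ => K * v ^ a) (Set.Ioc 0 1) :=
      ((integrableOn_Ioc_iff_integrableOn_Ioo (by simp)).2
        ((intervalIntegral.integrableOn_Ioo_rpow_iff one_pos).2 ha)).const_mul K
    exact Integrable.mono' hi (hf.mono_set Set.Ioc_subset_Ioi_self)
      ((ae_restrict_iff' measurableSet_Ioc).2 (ae_of_all _ fun v hv => h0 v hv.1 hv.2))
  · have hi : IntegrableOn (fun v : ℝ => K * v ^ b) (Set.Ioi 1) :=
      (integrableOn_Ioi_rpow_of_lt hb one_pos).const_mul K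
    exact Integrable.mono' hi (hf.mono_set (Set.Ioi_subset_Ioi zero_le_one))
      ((ae_restrict_iff' measurableSet_Ioi).2 (ae_of_all _ fun v hv => h1 v hv))

lemma integrableOn_min_one_rpow_div_sq {Y : ℝ} (h1 : 1 < Y) :
    IntegrableOn (fun v : ℝ => min 1 (v ^ Y) / v ^ 2) (Set.Ioi 0) := by
  refine integrableOn_Ioi_zero_of_norm_le_rpow (a := Y - 2) (b := -2) (K := 1) (by linarith)
    (by norm_num) (Measurable.aestronglyMeasurable (by fun_prop)) (fun v hv _ => ?_) (fun v hv => ?_)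
  · rw [Real.norm_of_nonneg (by positivity), one_mul, Real.rpow_sub hv, Real.rpow_two]
    gcongr
    exact min_le_right _ _
  · have hv0 : 0 < v := by linarith
    rw [Real.norm_of_nonneg (by positivity), one_mul, Real.rpow_neg hv0.le, Real.rpow_two,
      ← one_div]
    gcongr
    exact min_le_left _ _

lemma integrableOn_one_sub_exp_neg_mul_rpow {σ Y a : ℝ} (hσ : 0 < σ) (ha : 0 < a)
    (haY : a < Y) :
    IntegrableOn (fun v : ℝ => (1 - Real.exp (-σ * v ^ Y)) * v ^ (-a - 1)) (Set.Ioi 0) := by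
  have hb : ∀ v : ℝ, 0 < v → 0 ≤ 1 - Real.exp (-σ * v ^ Y) := fun v hv => by
    have : 0 ≤ σ * v ^ Y := by positivity
    have : Real.exp (-σ * v ^ Y) ≤ 1 := Real.exp_le_one_iff.2 (by linarith)
    linarith
  refine integrableOn_Ioi_zero_of_norm_le_rpow (a := Y - a - 1) (b := -a - 1) (K := 1 + σ)
    (by linarith) (by linarith) (by fun_prop) (fun v hv _ => ?_) (fun v hv => ?_)
  · have := one_sub_exp_neg_le_min hσ (by positivity : 0 ≤ v ^ Y)
    rw [Real.norm_of_nonneg (mul_nonneg (hb v hv) (by positivity)),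
      show Y - a - 1 = Y + (-a - 1) by ring, Real.rpow_add hv, ← mul_assoc]
    gcongr
    exact this.trans (by gcongr; exact min_le_right _ _)
  · have hv0 : 0 < v := by linarith
    have := one_sub_exp_neg_le_min hσ (by positivity : 0 ≤ v ^ Y)
    rw [Real.norm_of_nonneg (mul_nonneg (hb v hv0) (by positivity))]
    gcongr
    exact this.trans (mul_le_of_le_one_right (by positivity) (min_le_left _ _))

/-- The regularised Gamma integral. -/
lemma integral_one_sub_exp_neg_mul_rpow {σ Y a : ℝ} (hσ : 0 < σ) (hY : 0 < Y) (ha : 0 < a)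
    (haY : a < Y) :
    ∫ v in Set.Ioi (0 : ℝ), (1 - Real.exp (-σ * v ^ Y)) * v ^ (-a - 1)
      = σ ^ (a / Y) * Real.Gamma (1 - a / Y) / a := by
  set f : ℝ → ℝ := fun v => (1 - Real.exp (-σ * v ^ Y)) * v ^ (-a) with hf
  have hi1 := integrableOn_one_sub_exp_neg_mul_rpow hσ ha haY
  have hi2 : IntegrableOn (fun v : ℝ => v ^ (Y - 1 - a) * Real.exp (-σ * v ^ Y)) (Set.Ioi 0) :=
    integrableOn_rpow_mul_exp_neg_mul_rpow (by linarith) hY hσ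
  have hv2 := integral_rpow_mul_exp_neg_mul_rpow (p := Y) (q := Y - 1 - a) (b := σ) hY
    (by linarith) hσ
  have hder : ∀ v ∈ Set.Ioi (0 : ℝ), HasDerivAt f
      (σ * Y * (v ^ (Y - 1 - a) * Real.exp (-σ * v ^ Y))
        - a * ((1 - Real.exp (-σ * v ^ Y)) * v ^ (-a - 1))) v := by
    intro v hv
    have hv0 : (0 : ℝ) < v := hv
    have d1 := ((Real.hasDerivAt_rpow_const (p := Y) (Or.inl hv0.ne')).const_mul (-σ)).exp.const_sub 1
    have d2 := Real.hasDerivAt_rpow_const (p := -a) (Or.inl hv0.ne')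
    refine (d1.mul d2).congr_deriv ?_
    rw [show Y - 1 - a = (Y - 1) + -a by ring, Real.rpow_add hv0]
    ring
  have hbound : ∀ v : ℝ, 0 < v → 0 ≤ f v ∧ f v ≤ σ * v ^ (Y - a) ∧ f v ≤ v ^ (-a) := by
    intro v hv
    have p1 : 0 ≤ σ * v ^ Y := by positivity
    have p2 : Real.exp (-σ * v ^ Y) ≤ 1 := Real.exp_le_one_iff.2 (by linarith)
    have p3 := Real.add_one_le_exp (-σ * v ^ Y)
    have p4 := Real.exp_pos (-σ * v ^ Y)
    have p5 : 0 < v ^ (-a) := by positivity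
    refine ⟨mul_nonneg (by linarith) p5.le, ?_, ?_⟩
    · rw [sub_eq_add_neg Y a, Real.rpow_add hv, ← mul_assoc]
      exact mul_le_mul_of_nonneg_right (by linarith) p5.le
    · exact mul_le_of_le_one_left p5.le (by linarith)
  have hf0 : f 0 = 0 := by simp [hf, Real.zero_rpow hY.ne']
  have hcont : ContinuousWithinAt f (Set.Ici 0) 0 := by
    rw [← continuousWithinAt_Ioi_iff_Ici, ContinuousWithinAt, hf0]
    have hlim : Tendsto (fun v : ℝ => σ * v ^ (Y - a)) (𝓝[>] 0) (𝓝 0) := by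
      have : Tendsto (fun v : ℝ => σ * v ^ (Y - a)) (𝓝 0) (𝓝 (σ * 0 ^ (Y - a))) :=
        ((Real.continuousAt_rpow_const 0 (Y - a) (Or.inr (by linarith))).tendsto).const_mul σ
      rw [Real.zero_rpow (by linarith), mul_zero] at this
      exact this.mono_left nhdsWithin_le_nhds
    exact squeeze_zero' (eventually_mem_nhdsWithin.mono fun v hv => (hbound v hv).1)
      (eventually_mem_nhdsWithin.mono fun v hv => (hbound v hv).2.1) hlim
  have htop : Tendsto f atTop (𝓝 0) :=
    squeeze_zero' ((eventually_gt_atTop 0).mono fun v hv => (hbound v hv).1)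
      ((eventually_gt_atTop 0).mono fun v hv => (hbound v hv).2.2) (tendsto_rpow_neg_atTop ha)
  have key := integral_Ioi_of_hasDerivAt_of_tendsto hcont hder
    ((hi2.const_mul _).sub (hi1.const_mul _)) htop
  rw [integral_sub (hi2.const_mul _) (hi1.const_mul _), integral_const_mul, integral_const_mul,
    hv2, hf0, sub_self, sub_eq_zero] at key
  have e1 : (Y - 1 - a + 1) / Y = 1 - a / Y := by field_simp; ring
  have e2 : σ ^ (-(Y - 1 - a + 1) / Y) = σ ^ (a / Y) / σ := by
    rw [← Real.rpow_sub_one hσ.ne']; congr 1; field_simp; ring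
  rw [e1, e2] at key
  rw [eq_div_iff ha.ne', mul_comm, ← key]
  field_simp

lemma integral_one_sub_exp_mul_rpow_eq_Gamma {σ Y a : ℝ} (hσ : 0 < σ) (hY : 0 < Y) (ha : 0 < a)
    (haY : a < Y) :
    ∫ v in Set.Ioi (0 : ℝ), (1 - Real.exp (-σ * v ^ Y)) * v ^ (-a - 1)
      = -(σ ^ (a / Y) * Real.Gamma (-(a / Y)) / Y) := by
  have h : a / Y ≠ 0 := by positivity
  rw [integral_one_sub_exp_neg_mul_rpow hσ hY ha haY, sub_eq_neg_add,
    Real.Gamma_add_one (neg_ne_zero.2 h)]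
  field_simp

lemma measurable_thetaT (C G M Y t : ℝ) : Measurable (thetaT C G M Y t) := by
  unfold thetaT
  fun_prop

lemma thetaT_eq_add_thetaRem (C G M Y s v : ℝ) :
    thetaT C G M Y (s ^ Y) v = ((-(sigmaY C Y * v ^ Y) : ℝ) : ℂ)
      + Complex.I * ((btilde C G M Y * s ^ (Y - 1) * v : ℝ) : ℂ) + thetaRem C G M Y s v := by
  rw [thetaRem, Complex.ofReal_neg]
  ring

lemma thetaT_re (C G M Y s v : ℝ) :
    (thetaT C G M Y (s ^ Y) v).re = -(sigmaY C Y * v ^ Y) + (thetaRem C G M Y s v).re := by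
  rw [thetaT_eq_add_thetaRem, Complex.add_re, Complex.add_re, Complex.ofReal_re, mul_comm Complex.I,
    Complex.re_ofReal_mul, Complex.I_re]
  ring

lemma thetaT_one (C G M Y v : ℝ) : thetaT C G M Y 1 v = psi0 C G M Y v := by
  simp [thetaT, psi0]

lemma cpow_real_mul_re {s : ℝ} (hs : 0 < s) (z : ℂ) (Y : ℝ) :
    (((s : ℂ) * z) ^ (Y : ℂ)).re = s ^ Y * (z ^ (Y : ℂ)).re := by
  rw [Complex.cpow_ofReal_re, Complex.cpow_ofReal_re, Complex.arg_real_mul _ hs, norm_mul,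
    Complex.norm_real, Real.norm_of_nonneg hs.le, Real.mul_rpow hs.le (norm_nonneg _), mul_assoc]

lemma thetaT_scale_re {C G M Y s : ℝ} (hY : Y ≠ 0) (hs : 0 < s) (w : ℝ) :
    (thetaT C G M Y (s ^ Y) (s * w)).re = s ^ Y * (psi0 C G M Y w).re := by
  rw [thetaT_rpow hY hs, psi0]
  have e1 : ((((M - 1/2) * s : ℝ) : ℂ) + ((s * w : ℝ) : ℂ) * (-Complex.I))
      = (s : ℂ) * (((M - 1/2 : ℝ) : ℂ) - Complex.I * (w : ℂ)) := by push_cast; ring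
  have e2 : ((((G + 1/2) * s : ℝ) : ℂ) + ((s * w : ℝ) : ℂ) * Complex.I)
      = (s : ℂ) * (((G + 1/2 : ℝ) : ℂ) + Complex.I * (w : ℂ)) := by push_cast; ring
  have i1 : (Complex.I * ((s * w : ℝ) : ℂ) * (btilde C G M Y : ℂ) * ((s ^ (Y - 1) : ℝ) : ℂ)).re = 0 := by
    rw [mul_assoc, mul_assoc, ← Complex.ofReal_mul, ← Complex.ofReal_mul, mul_comm,
      Complex.re_ofReal_mul, Complex.I_re, mul_zero]
  have i2 : (Complex.I * (w : ℂ) * (btilde C G M Y : ℂ)).re = 0 := by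
    rw [mul_assoc, ← Complex.ofReal_mul, mul_comm, Complex.re_ofReal_mul, Complex.I_re, mul_zero]
  rw [e1, e2]
  simp only [Complex.add_re, i1, i2, Complex.re_ofReal_mul, cpow_real_mul_re hs, Complex.ofReal_re]
  ring

/-- The integrand of `dTwo`. -/
noncomputable def dTwoIntegrand (C G M Y w : ℝ) : ℝ :=
  ((w ^ 2 + 1/4) * theta0 C Y w - w ^ 2 * (psi0 C G M Y w).re) / (w ^ 2 * (w ^ 2 + 1/4))

/-- The rescaled integrand of `dTwo`. -/
noncomputable def dTwoScaled (C G M Y s v : ℝ) : ℝ :=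
  (-(sigmaY C Y * v ^ Y) - v ^ 2 / (v ^ 2 + s ^ 2 / 4) * (thetaT C G M Y (s ^ Y) v).re) / v ^ 2

lemma dTwoScaled_mul {C G M Y s w : ℝ} (hY : Y ≠ 0) (hs : 0 < s) (hw : 0 < w) :
    dTwoScaled C G M Y s (s * w) = s ^ Y / s ^ 2 * dTwoIntegrand C G M Y w := by
  rw [dTwoScaled, dTwoIntegrand, thetaT_scale_re hY hs, Real.mul_rpow hs.le hw.le, theta0,
    abs_of_pos hw]
  have : 0 < w ^ 2 + 1 / 4 := by positivity
  have : (s * w) ^ 2 + s ^ 2 / 4 = s ^ 2 * (w ^ 2 + 1 / 4) := by ring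
  rw [this]
  field_simp

lemma integrableOn_dTwoIntegrand {C G M Y : ℝ} (hC : 0 < C) (hG : 0 ≤ G) (hM : 1 < M)
    (h1 : 1 < Y) (h2 : Y < 2) : IntegrableOn (dTwoIntegrand C G M Y) (Set.Ioi 0) := by
  obtain ⟨K, hK, hR⟩ := thetaRem_bounds hC hG hM h1 h2
  have hσ := sigmaY_pos hC h1 h2
  set σ := sigmaY C Y with hσdef
  have hmeas : Measurable (dTwoIntegrand C G M Y) := by
    have : Measurable (psi0 C G M Y) := by
      unfold psi0
      fun_prop
    unfold dTwoIntegrand theta0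
    fun_prop
  have hform : ∀ w : ℝ, 0 < w → ∃ r : ℝ, |r| ≤ K * (w ^ Y / w + 1) ∧
      dTwoIntegrand C G M Y w = -(σ * w ^ Y) / (w ^ 2 * (4 * w ^ 2 + 1)) - 4 * r / (4 * w ^ 2 + 1) := by
    intro w hw
    refine ⟨(thetaRem C G M Y 1 w).re, ?_, ?_⟩
    · have := (hR 1 w one_pos hw).1
      rw [Real.one_rpow, one_mul, Real.rpow_sub_one hw.ne'] at this
      exact (Complex.abs_re_le_norm _).trans this
    · have := thetaT_re C G M Y 1 w
      rw [Real.one_rpow, thetaT_one] at this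
      rw [dTwoIntegrand, theta0, this, abs_of_pos hw, ← hσdef]
      field_simp
      ring
  refine integrableOn_Ioi_zero_of_norm_le_rpow (a := Y - 2) (b := Y - 3) (K := σ + 8 * K)
    (by linarith) (by linarith) hmeas.aestronglyMeasurable (fun w hw hw1 => ?_) (fun w hw1 => ?_)
  · obtain ⟨r, hr, he⟩ := hform w hw
    have q1 : w ^ Y ≤ w := by
      simpa using Real.rpow_le_rpow_of_exponent_ge hw hw1 h1.le
    have q2 : w ^ Y / w ≤ 1 := div_le_one_of_le₀ q1 hw.le
    have q3 : 1 ≤ w ^ (Y - 2) := Real.one_le_rpow_of_pos_of_le_one_of_nonpos hw hw1 (by linarith)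
    have q4 : w ^ (Y - 2) = w ^ Y / w ^ 2 := by rw [Real.rpow_sub hw, Real.rpow_two]
    have hr' : |r| ≤ 2 * K := hr.trans (by nlinarith)
    rw [he, Real.norm_eq_abs]
    refine (abs_sub _ _).trans ?_
    have t1 : |-(σ * w ^ Y) / (w ^ 2 * (4 * w ^ 2 + 1))| ≤ σ * w ^ (Y - 2) := by
      rw [abs_div, abs_neg, abs_of_nonneg (by positivity), abs_of_nonneg (by positivity), q4,
        ← mul_div_assoc]
      gcongr
      exact le_mul_of_one_le_right (by positivity) (by nlinarith)
    have t2 : |4 * r / (4 * w ^ 2 + 1)| ≤ 8 * K * w ^ (Y - 2) := by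
      rw [abs_div, abs_mul, abs_of_pos (by positivity : (0 : ℝ) < 4 * w ^ 2 + 1),
        abs_of_pos (by norm_num : (0 : ℝ) < 4)]
      calc 4 * |r| / (4 * w ^ 2 + 1) ≤ 4 * |r| := div_le_self (by positivity) (by nlinarith)
        _ ≤ 8 * K * 1 := by linarith
        _ ≤ _ := by gcongr
    linarith
  · have hw : 0 < w := by linarith
    obtain ⟨r, hr, he⟩ := hform w hw
    have q1 : w ≤ w ^ Y := by
      simpa using Real.rpow_le_rpow_of_exponent_le hw1.le h1.le
    have q2 : 1 ≤ w ^ Y / w := (one_le_div hw).2 q1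
    have q4 : w ^ (Y - 3) = w ^ Y / w / w ^ 2 := by
      rw [show Y - 3 = Y - 1 - 2 by ring, Real.rpow_sub hw, Real.rpow_two, Real.rpow_sub_one hw.ne']
    have hr' : |r| ≤ 2 * K * (w ^ Y / w) := hr.trans (by nlinarith)
    rw [he, Real.norm_eq_abs]
    refine (abs_sub _ _).trans ?_
    have t1 : |-(σ * w ^ Y) / (w ^ 2 * (4 * w ^ 2 + 1))| ≤ σ * w ^ (Y - 3) := by
      rw [abs_div, abs_neg, abs_of_nonneg (by positivity), abs_of_nonneg (by positivity), q4,
        div_div, ← mul_div_assoc, mul_comm w]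
      gcongr
      nlinarith
    have t2 : |4 * r / (4 * w ^ 2 + 1)| ≤ 8 * K * w ^ (Y - 3) := by
      rw [abs_div, abs_mul, abs_of_pos (by positivity : (0 : ℝ) < 4 * w ^ 2 + 1),
        abs_of_pos (by norm_num : (0 : ℝ) < 4), q4]
      have : 0 ≤ 2 * K * (w ^ Y / w) := by positivity
      calc 4 * |r| / (4 * w ^ 2 + 1) ≤ 4 * (2 * K * (w ^ Y / w)) / (w ^ 2) := by
            gcongr
            nlinarith
        _ = _ := by ring
    linarith

lemma integrableOn_dTwoScaled {C G M Y s : ℝ} (hC : 0 < C) (hG : 0 ≤ G) (hM : 1 < M)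
    (h1 : 1 < Y) (h2 : Y < 2) (hs : 0 < s) : IntegrableOn (dTwoScaled C G M Y s) (Set.Ioi 0) := by
  have := (integrableOn_Ioi_comp_mul_left_iff (dTwoScaled C G M Y s) 0 hs).1
  rw [mul_zero] at this
  have hi : IntegrableOn (fun w => s ^ Y / s ^ 2 * dTwoIntegrand C G M Y w) (Set.Ioi 0) :=
    (integrableOn_dTwoIntegrand hC hG hM h1 h2).const_mul _
  exact this (hi.congr_fun
    (fun w hw => (dTwoScaled_mul (by linarith) hs hw).symm) measurableSet_Ioi)

lemma integral_dTwoScaled {C G M Y s : ℝ} (hY : Y ≠ 0) (hs : 0 < s) :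
    ∫ v in Set.Ioi (0 : ℝ), dTwoScaled C G M Y s v
      = s ^ (Y - 1) * (Real.pi * dTwo C G M Y) := by
  have h := integral_comp_mul_left_Ioi (dTwoScaled C G M Y s) 0 hs
  rw [mul_zero, setIntegral_congr_fun measurableSet_Ioi
    (fun w hw => dTwoScaled_mul (C := C) (G := G) (M := M) hY hs hw), integral_const_mul,
    smul_eq_mul] at h
  have hd : Real.pi * dTwo C G M Y = ∫ w in Set.Ioi (0 : ℝ), dTwoIntegrand C G M Y w := by
    rw [dTwo, ← mul_assoc, mul_one_div_cancel Real.pi_ne_zero, one_mul]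
    rfl
  rw [hd, Real.rpow_sub_one hs.ne']
  field_simp at h ⊢
  linarith

/-! ### The expansion of `LLfn` -/

lemma integrableOn_LLfn_integrand {C G M Y s : ℝ} (hC : 0 < C) (hG : 0 ≤ G) (hM : 1 < M)
    (h1 : 1 < Y) (h2 : Y < 2) (hs : 0 < s) (hs1 : s ≤ 1) :
    IntegrableOn (fun v : ℝ => (1 - Complex.exp (thetaT C G M Y (s ^ Y) v))
      / (((v ^ 2 + s ^ 2 / 4 : ℝ)) : ℂ)) (Set.Ioi 0) := by
  obtain ⟨K, hK, hR⟩ := thetaRem_bounds hC hG hM h1 h2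
  have hσ := sigmaY_pos hC h1 h2
  set D := Real.exp (K + K * (2 * K / sigmaY C Y) ^ (Y - 1)) with hD
  have hnum : ∀ v : ℝ, 0 < v → ‖1 - Complex.exp (thetaT C G M Y (s ^ Y) v)‖ ≤ 1 + D := by
    intro v hv
    refine (norm_sub_le _ _).trans ?_
    rw [norm_one, Complex.norm_exp, thetaT_re]
    refine add_le_add le_rfl (Real.exp_le_exp.2 ?_)
    have b1 := (Complex.re_le_norm _).trans (hR s v hs hv).1
    have b2 := mul_rpow_sub_one_le hK hσ h1 hv
    have b3 : s ^ Y ≤ 1 := Real.rpow_le_one hs.le hs1 (by linarith)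
    have b4 : s * v ^ (Y - 1) ≤ v ^ (Y - 1) := mul_le_of_le_one_left (by positivity) hs1
    have b5 : K * (s * v ^ (Y - 1) + s ^ Y) ≤ K * (v ^ (Y - 1) + 1) := by gcongr
    have b6 : 0 ≤ sigmaY C Y * v ^ Y := by positivity
    linarith
  have hmeas : Measurable (fun v : ℝ => (1 - Complex.exp (thetaT C G M Y (s ^ Y) v))
      / (((v ^ 2 + s ^ 2 / 4 : ℝ)) : ℂ)) := by
    have := measurable_thetaT C G M Y (s ^ Y)
    fun_prop
  have hden : ∀ v : ℝ, ‖((v ^ 2 + s ^ 2 / 4 : ℝ) : ℂ)‖ = v ^ 2 + s ^ 2 / 4 := fun v => by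
    rw [Complex.norm_real, Real.norm_of_nonneg (by positivity)]
  have hD0 : 0 ≤ 1 + D := by positivity
  refine integrableOn_Ioi_zero_of_norm_le_rpow (a := 0) (b := -2) (K := (1 + D) * (1 + 4 / s ^ 2))
    (by norm_num) (by norm_num) hmeas.aestronglyMeasurable (fun v hv _ => ?_) (fun v hv => ?_)
  · rw [norm_div, hden, Real.rpow_zero, mul_one]
    calc _ ≤ (1 + D) / (s ^ 2 / 4) := by
          gcongr
          · exact hnum v hv
          · nlinarith
      _ = (1 + D) * (4 / s ^ 2) := by field_simp
      _ ≤ _ := by gcongr; linarith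
  · have hv0 : 0 < v := by linarith
    rw [norm_div, hden, Real.rpow_neg hv0.le, Real.rpow_two, ← div_eq_mul_inv]
    have : 0 < s ^ 2 := by positivity
    have : 1 + D ≤ (1 + D) * (1 + 4 / s ^ 2) := le_mul_of_one_le_right hD0 (by
      have : 0 ≤ 4 / s ^ 2 := by positivity
      linarith)
    gcongr
    · exact (hnum v hv0).trans this
    · linarith

lemma LLfn_rpow {C G M Y s : ℝ} (hC : 0 < C) (hG : 0 ≤ G) (hM : 1 < M)
    (h1 : 1 < Y) (h2 : Y < 2) (hs : 0 < s) (hs1 : s ≤ 1) :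
    LLfn C G M Y (s ^ Y) = 1 / Real.pi * ∫ v in Set.Ioi (0 : ℝ),
      (1 - Complex.exp (thetaT C G M Y (s ^ Y) v)).re / (v ^ 2 + s ^ 2 / 4) := by
  have hY : Y ≠ 0 := by linarith
  have e : (s ^ Y) ^ (2 / Y) = s ^ 2 := by
    rw [← Real.rpow_mul hs.le, mul_div_cancel₀ _ hY, Real.rpow_two]
  have h := integral_re (integrableOn_LLfn_integrand hC hG hM h1 h2 hs hs1)
  simp only [RCLike.re_eq_complex_re, Complex.div_ofReal_re] at h
  rw [LLfn, e, h]

/-- The explicit main terms of the integrand of `LLfn` along `t = s ^ Y`. -/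
noncomputable def mainIntegrand (C G M Y s v : ℝ) : ℝ :=
  (1 - Real.exp (-sigmaY C Y * v ^ Y)) * v ^ (-1 - 1 : ℝ) + dTwoScaled C G M Y s v
    + (btilde C G M Y * s ^ (Y - 1)) ^ 2 / 2 * (v ^ (0 : ℝ) * Real.exp (-sigmaY C Y * v ^ Y))
    + -((btilde C G M Y * s ^ (Y - 1)) ^ 4 / 24)
      * (v ^ (2 : ℝ) * Real.exp (-sigmaY C Y * v ^ Y))
    + skewCoeff C G M Y * s
      * ((1 - Real.exp (-sigmaY C Y * v ^ Y)) * v ^ (-(2 - Y) - 1))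

lemma integral_mainIntegrand {C G M Y s : ℝ} (hC : 0 < C) (hG : 0 ≤ G) (hM : 1 < M)
    (h1 : 1 < Y) (h2 : Y < 2) (hs : 0 < s) :
    IntegrableOn (mainIntegrand C G M Y s) (Set.Ioi 0) ∧
    ∫ v in Set.Ioi (0 : ℝ), mainIntegrand C G M Y s v
      = Real.pi * (dOne C Y + dTwo C G M Y * s ^ (Y - 1)
        + ((btilde C G M Y) ^ 2 * (sigmaY C Y) ^ (-(1/Y)) * Real.Gamma (1/Y)
            / (2 * Real.pi * Y)) * (s ^ (Y - 1)) ^ 2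
        + (-((btilde C G M Y) ^ 4 * (sigmaY C Y) ^ (-(3/Y)) * Real.Gamma (3/Y)
            / (24 * Real.pi * Y))) * (s ^ (Y - 1)) ^ 4
        + (-(C * Real.Gamma (-Y) * ((M - 1/2) + (G + 1/2)) * Real.sin (Y * Real.pi / 2)
            / Real.pi) * Real.Gamma (1 - 2/Y) * (sigmaY C Y) ^ ((2 - Y)/Y)) * s) := by
  have hσ := sigmaY_pos hC h1 h2
  have hY : 0 < Y := by linarith
  have i1 := integrableOn_one_sub_exp_neg_mul_rpow hσ one_pos h1
  have i2 := integrableOn_dTwoScaled hC hG hM h1 h2 hs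
  have i3 := (integrableOn_rpow_mul_exp_neg_mul_rpow (p := Y) (s := 0) (by norm_num)
    hY hσ).const_mul ((btilde C G M Y * s ^ (Y - 1)) ^ 2 / 2)
  have i4 := (integrableOn_rpow_mul_exp_neg_mul_rpow (p := Y) (s := 2) (by norm_num)
    hY hσ).const_mul (-((btilde C G M Y * s ^ (Y - 1)) ^ 4 / 24))
  have i5 := (integrableOn_one_sub_exp_neg_mul_rpow hσ (sub_pos.2 h2)
    (by linarith : 2 - Y < Y)).const_mul (skewCoeff C G M Y * s)
  refine ⟨(((i1.add i2).add i3).add i4).add i5, ?_⟩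
  have v1 := integral_one_sub_exp_neg_mul_rpow hσ hY one_pos h1
  have v3 := integral_rpow_mul_exp_neg_mul_rpow (p := Y) (q := 0) hY (by norm_num) hσ
  have v4 := integral_rpow_mul_exp_neg_mul_rpow (p := Y) (q := 2) hY (by norm_num) hσ
  have v5 := integral_one_sub_exp_mul_rpow_eq_Gamma hσ hY (sub_pos.2 h2)
    (by linarith : 2 - Y < Y)
  have e3 : -(0 + 1) / Y = -(1 / Y) := by ring
  have e4 : -(2 + 1) / Y = -(3 / Y) := by ring
  have e5 : -((2 - Y) / Y) = 1 - 2 / Y := by field_simp; ring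
  rw [e3, zero_add] at v3
  rw [e4, show (2 : ℝ) + 1 = 3 by norm_num] at v4
  rw [e5] at v5
  refine (integral_add' (((i1.add i2).add i3).add i4) i5).trans ?_
  rw [integral_add' ((i1.add i2).add i3) i4, integral_add' (i1.add i2) i3, integral_add' i1 i2,
    integral_const_mul, integral_const_mul,
    integral_const_mul, v1, integral_dTwoScaled hY.ne' hs, v3, v4, v5, dOne, skewCoeff]
  field_simp

lemma abs_LLfn_sub_le {C G M Y : ℝ} (hC : 0 < C) (hG : 0 ≤ G) (hM : 1 < M)
    (h1 : 1 < Y) (h2 : Y < 2) : ∃ K : ℝ, ∀ s : ℝ, 0 < s → s ≤ 1 →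
      |LLfn C G M Y (s ^ Y) - (dOne C Y + dTwo C G M Y * s ^ (Y - 1)
        + ((btilde C G M Y) ^ 2 * (sigmaY C Y) ^ (-(1/Y)) * Real.Gamma (1/Y)
            / (2 * Real.pi * Y)) * (s ^ (Y - 1)) ^ 2
        + (-((btilde C G M Y) ^ 4 * (sigmaY C Y) ^ (-(3/Y)) * Real.Gamma (3/Y)
            / (24 * Real.pi * Y))) * (s ^ (Y - 1)) ^ 4
        + (-(C * Real.Gamma (-Y) * ((M - 1/2) + (G + 1/2)) * Real.sin (Y * Real.pi / 2)
            / Real.pi) * Real.Gamma (1 - 2/Y) * (sigmaY C Y) ^ ((2 - Y)/Y)) * s)|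
      ≤ K * (s ^ Y + s ^ (6 * Y - 6)) := by
  obtain ⟨K, hK, hR⟩ := thetaRem_bounds hC hG hM h1 h2
  have hσ := sigmaY_pos hC h1 h2
  obtain ⟨K', hK', hexp⟩ := integrand_expansion (b := btilde C G M Y) (c := skewCoeff C G M Y)
    hσ hK h1 h2
  refine ⟨1 / Real.pi * (K' * ∫ v in Set.Ioi (0 : ℝ), min 1 (v ^ Y) / v ^ 2),
    fun s hs hs1 => ?_⟩
  obtain ⟨hi, hv⟩ := integral_mainIntegrand hC hG hM h1 h2 hs
  have hF := (integrableOn_LLfn_integrand hC hG hM h1 h2 hs hs1).re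
  simp only [RCLike.re_eq_complex_re, Complex.div_ofReal_re] at hF
  have hpt : ∀ v ∈ Set.Ioi (0 : ℝ),
      ‖(1 - Complex.exp (thetaT C G M Y (s ^ Y) v)).re / (v ^ 2 + s ^ 2 / 4)
        - mainIntegrand C G M Y s v‖
      ≤ K' * (s ^ Y + s ^ (6 * Y - 6)) * (min 1 (v ^ Y) / v ^ 2) := by
    intro v hv0
    have hv0 : 0 < v := hv0
    have h := hexp s v hs hs1 hv0 _ (hR s v hs hv0).1 (hR s v hs hv0).2
    rw [← thetaT_eq_add_thetaRem, ← thetaT_re] at h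
    rw [← mul_div_assoc, le_div_iff₀ (by positivity), Real.norm_eq_abs]
    refine le_trans (le_of_eq ?_) h
    rw [← abs_of_pos (pow_pos hv0 2), ← abs_mul, abs_of_pos (pow_pos hv0 2), mainIntegrand,
      dTwoScaled, show (-(2 - Y) - 1) = (Y - 1) - 2 by ring, Real.rpow_sub hv0 (Y - 1) 2,
      show (-1 - 1 : ℝ) = -2 by norm_num, Real.rpow_neg hv0.le, Real.rpow_two, Real.rpow_zero,
      neg_mul]
    congr 1
    field_simp
    ring
  have hdiff := norm_integral_le_of_norm_le
    ((integrableOn_min_one_rpow_div_sq h1).const_mul (K' * (s ^ Y + s ^ (6 * Y - 6))))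
    ((ae_restrict_iff' measurableSet_Ioi).2 (ae_of_all _ hpt))
  rw [integral_sub hF hi, hv, integral_const_mul, Real.norm_eq_abs] at hdiff
  rw [LLfn_rpow hC hG hM h1 h2 hs hs1]
  set I := ∫ v in Set.Ioi (0 : ℝ),
      (1 - Complex.exp (thetaT C G M Y (s ^ Y) v)).re / (v ^ 2 + s ^ 2 / 4)
  have hpi : ∀ x : ℝ, |1 / Real.pi * I - x| = 1 / Real.pi * |I - Real.pi * x| := fun x => by
    rw [← abs_of_pos (by positivity : 0 < 1 / Real.pi), ← abs_mul,
      abs_of_pos (by positivity : 0 < 1 / Real.pi)]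
    congr 1
    field_simp
  rw [hpi]
  calc _ ≤ _ := mul_le_mul_of_nonneg_left hdiff (by positivity)
    _ = _ := by ring

lemma tendsto_const_mul_rpow_nhdsGT_zero (K : ℝ) {p : ℝ} (hp : 0 < p) :
    Tendsto (fun t : ℝ => K * t ^ p) (𝓝[>] 0) (𝓝 0) := by
  have h := ((Real.continuousAt_rpow_const 0 p (Or.inr hp.le)).tendsto).const_mul K
  rw [Real.zero_rpow hp.ne', mul_zero] at h
  exact h.mono_left nhdsWithin_le_nhds

/-- Five-term ATM expansion for `Y ∈ (7/6, 2)`: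
`t^{1/Y}·L(t) = d₁·t^{1/Y} + d₂·t + a₂₁·t^{2-1/Y} + a₄₁·t^{4-3/Y} + a₁₂·t^{2/Y}
  + o(t^{max(2-1/Y,2/Y)})` as `t → 0⁺`. -/
theorem stmt12 (C G M Y : ℝ) (hC : 0 < C) (hG : 0 ≤ G) (hM : 1 < M)
    (hY1 : 7/6 < Y) (hY2 : Y < 2) :
    Tendsto
      (fun t : ℝ =>
        (t ^ (1/Y) * LLfn C G M Y t
          - dOne C Y * t ^ (1/Y)
          - dTwo C G M Y * t
          - ((btilde C G M Y) ^ 2 * (sigmaY C Y) ^ (-(1/Y)) * Real.Gamma (1/Y)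
              / (2 * Real.pi * Y)) * t ^ (2 - 1/Y)
          - (-((btilde C G M Y) ^ 4 * (sigmaY C Y) ^ (-(3/Y)) * Real.Gamma (3/Y)
              / (24 * Real.pi * Y))) * t ^ (4 - 3/Y)
          - (-(C * Real.Gamma (-Y) * ((M - 1/2) + (G + 1/2)) * Real.sin (Y * Real.pi / 2)
              / Real.pi) * Real.Gamma (1 - 2/Y) * (sigmaY C Y) ^ ((2 - Y)/Y))
              * t ^ (2/Y))
          / t ^ (max (2 - 1/Y) (2/Y)))
      (𝓝[>] 0) (𝓝 0) := by
  have h1 : 1 < Y := by linarith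
  have hY0 : 0 < Y := by linarith
  obtain ⟨K, hK⟩ := abs_LLfn_sub_le hC hG hM h1 hY2
  set m := max (2 - 1/Y) (2/Y) with hm
  have hr1 : 1 / 2 < 1 / Y := one_div_lt_one_div_of_lt hY0 hY2
  have hr2 : 1 / Y < 6 / 7 := by
    rw [div_lt_div_iff₀ hY0 (by norm_num)]
    linarith
  have e2 : 2 / Y = 2 * (1 / Y) := by ring
  have e3 : 3 / Y = 3 * (1 / Y) := by ring
  have hm1 : m < 1 + 1 / Y := max_lt (by linarith) (by linarith)
  have hm2 : m < 6 - 5 * (1 / Y) := max_lt (by linarith) (by linarith)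
  have hlim := (tendsto_const_mul_rpow_nhdsGT_zero K (sub_pos.2 hm1)).add
    (tendsto_const_mul_rpow_nhdsGT_zero K (sub_pos.2 hm2))
  rw [add_zero] at hlim
  refine squeeze_zero_norm' ?_ hlim
  filter_upwards [Ioc_mem_nhdsGT one_pos] with t ht
  have ht0 : 0 < t := ht.1
  have hs0 : 0 < t ^ (1 / Y) := by positivity
  have hpow : ∀ p : ℝ, (t ^ (1 / Y)) ^ p = t ^ (1 / Y * p) := fun p =>
    (Real.rpow_mul ht0.le _ _).symm
  have h := hK (t ^ (1 / Y)) hs0 (Real.rpow_le_one ht0.le ht.2 (by positivity))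
  have hYr : 1 / Y * Y = 1 := one_div_mul_cancel hY0.ne'
  have q0 : (t ^ (1 / Y)) ^ Y = t := by rw [hpow, hYr, Real.rpow_one]
  have q1 : t = t ^ (1 / Y) * (t ^ (1 / Y)) ^ (Y - 1) := by
    rw [Real.rpow_sub_one hs0.ne', q0]
    field_simp
  have q2 : t ^ (2 - 1 / Y) = t ^ (1 / Y) * ((t ^ (1 / Y)) ^ (Y - 1)) ^ 2 := by
    rw [← Real.rpow_natCast, hpow, ← Real.rpow_mul ht0.le, ← Real.rpow_add ht0]
    congr 1
    push_cast
    linear_combination -2 * hYr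
  have q4 : t ^ (4 - 3 / Y) = t ^ (1 / Y) * ((t ^ (1 / Y)) ^ (Y - 1)) ^ 4 := by
    rw [← Real.rpow_natCast, hpow, ← Real.rpow_mul ht0.le, ← Real.rpow_add ht0]
    congr 1
    push_cast
    linear_combination -4 * hYr - e3
  have q5 : t ^ (2 / Y) = t ^ (1 / Y) * t ^ (1 / Y) := by
    rw [← Real.rpow_add ht0]
    congr 1
    ring
  have q6 : (t ^ (1 / Y)) ^ (6 * Y - 6) = t ^ (6 - 6 * (1 / Y)) := by
    rw [hpow]
    congr 1
    linear_combination 6 * hYr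
  rw [q6, q0] at h
  rw [norm_div, Real.norm_of_nonneg (by positivity : 0 ≤ t ^ m), div_le_iff₀ (by positivity),
    Real.norm_eq_abs]
  have hrhs : (K * t ^ (1 + 1 / Y - m) + K * t ^ (6 - 5 * (1 / Y) - m)) * t ^ m
      = t ^ (1 / Y) * (K * (t + t ^ (6 - 6 * (1 / Y)))) := by
    have r1 : t ^ (1 + 1 / Y - m) * t ^ m = t * t ^ (1 / Y) := by
      rw [← Real.rpow_add ht0, sub_add_cancel, Real.rpow_add ht0, Real.rpow_one]
    have r2 : t ^ (6 - 5 * (1 / Y) - m) * t ^ m = t ^ (1 / Y) * t ^ (6 - 6 * (1 / Y)) := by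
      rw [← Real.rpow_add ht0, ← Real.rpow_add ht0]
      congr 1
      ring
    linear_combination K * r1 + K * r2
  rw [hrhs]
  refine le_trans (le_of_eq ?_) (mul_le_mul_of_nonneg_left h hs0.le)
  have habs : ∀ x : ℝ, t ^ (1 / Y) * |x| = |t ^ (1 / Y) * x| := fun x => by
    rw [abs_mul, abs_of_pos hs0]
  rw [habs]
  congr 1
  rw [q2, q4, q5]
  linear_combination -dTwo C G M Y * q1
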